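/- Let K be a field, V a finite-dimensional K-vector space, f : V → V a linear endomorphism, and V = V₁ ⊇ V₂ ⊇ ⋯ ⊇ V_n ⊇ V_{n+1} = 0 a descending chain of f-invariant subspaces. For each a with 1 ≤ a ≤ n let f̄_a denote the endomorphism induced by f on the quotient V_a/V_{a+1}, and suppose the characteristic polynomials of f̄_1, …, f̄_n are pairwise coprime in K[X]. Then there exists a unique linear isomorphism Ψ : V → ⊕_{a=1}^{n} V_a/V_{a+1} such that Ψ ∘ f = (⊕_a f̄_a) ∘ Ψ, Ψ(V_a) ⊆ ⊕_{i ≥ a} V_i/V_{i+1} for every a, and for every a the map V_a/V_{a+1} → V_a/V_{a+1} induced by Ψ is the identity. -/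

import Mathlib

section

variable {K V : Type*} [Field K] [AddCommGroup V] [Module K V]

/-- The graded piece `V_a / V_{a+1}` of a descending chain of submodules. -/
abbrev GradedPiece (Vs : ℕ → Submodule K V) (a : ℕ) : Type _ :=
  ↥(Vs a) ⧸ (Submodule.comap (Vs a).subtype (Vs (a + 1)))

/-- The endomorphism `f̄_a` induced on the graded piece `V_a / V_{a+1}` by an
endomorphism `f` preserving `V_a` and `V_{a+1}`. -/
def gradedMap (f : V →ₗ[K] V) (Vs : ℕ → Submodule K V) (a : ℕ)
    (ha : ∀ x ∈ Vs a, f x ∈ Vs a) (ha' : ∀ x ∈ Vs (a + 1), f x ∈ Vs (a + 1)) :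
    GradedPiece Vs a →ₗ[K] GradedPiece Vs a :=
  Submodule.mapQ _ _ (f.restrict ha) (fun x hx => ha' x hx)

/-- The endomorphism `f̄_a` induced on the `a`-th graded piece (`a = i + 1` for
`i : Fin n`) of a chain which is `f`-invariant in degrees `1, …, n + 1`. -/
def gradedMapAt (n : ℕ) (f : V →ₗ[K] V) (Vs : ℕ → Submodule K V)
    (hinv : ∀ a, 1 ≤ a → a ≤ n + 1 → ∀ x ∈ Vs a, f x ∈ Vs a) (i : Fin n) :
    GradedPiece Vs (i.val + 1) →ₗ[K] GradedPiece Vs (i.val + 1) :=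
  gradedMap f Vs (i.val + 1)
    (hinv (i.val + 1) (Nat.le_add_left 1 i.val) (Nat.succ_le_succ i.isLt.le))
    (hinv (i.val + 2) (Nat.le_add_left 1 (i.val + 1))
      (Nat.succ_le_succ (Nat.succ_le_of_lt i.isLt)))

/-- The block-diagonal endomorphism `⊕_a f̄_a` of `⊕_{a=1}^{n} V_a / V_{a+1}`. -/
def blockMap (n : ℕ) (f : V →ₗ[K] V) (Vs : ℕ → Submodule K V)
    (hinv : ∀ a, 1 ≤ a → a ≤ n + 1 → ∀ x ∈ Vs a, f x ∈ Vs a) :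
    ((i : Fin n) → GradedPiece Vs (i.val + 1)) →ₗ[K]
      ((i : Fin n) → GradedPiece Vs (i.val + 1)) :=
  LinearMap.pi fun i => (gradedMapAt n f Vs hinv i).comp (LinearMap.proj i)

open Polynomial in
/-- A linear map intertwining `f` and `g` intertwines `p(f)` and `p(g)`. -/
theorem LinearMap.map_aeval_of_intertwines {R M N : Type*} [CommSemiring R]
    [AddCommMonoid M] [Module R M] [AddCommMonoid N] [Module R N]
    {f : M →ₗ[R] M} {g : N →ₗ[R] N} {φ : M →ₗ[R] N}
    (h : ∀ x, φ (f x) = g (φ x)) (p : R[X]) (x : M) :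
    φ (aeval f p x) = aeval g p (φ x) := by
  induction p using Polynomial.induction_on' with
  | add p q hp hq => simp [hp, hq]
  | monomial k c =>
    have hk : ∀ x, φ ((f ^ k) x) = (g ^ k) (φ x) := by
      induction k with
      | zero => simp
      | succ k ih => intro x; simp [pow_succ, ih, h]
    simp [aeval_monomial, hk]

open Polynomial in
/-- An equivariant map `π : A → N` on an `f`-invariant submodule `A` extends uniquely to an
equivariant map on the whole module, provided that `q(f)` maps into `A` for some `q` coprime to
a polynomial annihilating the endomorphism of `N`. -/
theorem LinearMap.existsUnique_equivariant_extension {R M N : Type*} [CommRing R]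
    [AddCommGroup M] [Module R M] [AddCommGroup N] [Module R N]
    {f : M →ₗ[R] M} {g : N →ₗ[R] N} {A : Submodule R M} (hA : ∀ x ∈ A, f x ∈ A)
    (π : A →ₗ[R] N) (hπ : ∀ x, π (f.restrict hA x) = g (π x)) {p q : R[X]}
    (hq : ∀ x, aeval f q x ∈ A) (hp : aeval g p = 0) (hqp : IsCoprime q p) :
    ∃! φ : M →ₗ[R] N, (∀ x, φ (f x) = g (φ x)) ∧ ∀ x : A, φ x = π x := by
  obtain ⟨u, w, h⟩ := hqp
  have hdec (x : M) : x = aeval f q (aeval f u x) + aeval f p (aeval f w x) := by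
    have := congrArg (fun r => aeval f r x) h
    simpa [mul_comm u, mul_comm w] using this.symm
  let e : M →ₗ[R] A := ((aeval f q).codRestrict A hq).comp (aeval f u)
  have he (x : M) : (e x : M) = aeval f q (aeval f u x) := rfl
  refine ⟨π.comp e, ⟨fun x => ?_, fun x => ?_⟩, fun φ hφ => ?_⟩
  · change π (e (f x)) = g (π (e x))
    rw [← hπ]
    congr 1
    ext
    rw [LinearMap.coe_restrict_apply, he, he]
    have hc (r : R[X]) (y : M) : aeval f r (f y) = f (aeval f r y) :=
      (map_aeval_of_intertwines (φ := f) (fun _ => rfl) r y).symm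
    rw [hc, hc]
  · have hx : x = e x + aeval (f.restrict hA) p (aeval (f.restrict hA) w x) := by
      have hs (r : R[X]) (y : A) : ((aeval (f.restrict hA) r y : A) : M) = aeval f r (y : M) :=
        map_aeval_of_intertwines (φ := A.subtype) (fun _ => rfl) r y
      ext
      rw [Submodule.coe_add, hs, hs, he]
      exact hdec x
    conv_rhs => rw [hx]
    rw [map_add, map_aeval_of_intertwines hπ, hp]
    simp
  · ext x
    conv_lhs => rw [hdec x]
    rw [map_add, map_aeval_of_intertwines hφ.1 p, hp, ← he, hφ.2]
    simp

section Filtration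

variable (n : ℕ) (f : V →ₗ[K] V) (Vs : ℕ → Submodule K V)

/-- A product of polynomials annihilating the first `k` graded pieces maps the whole space into
the next step of the filtration. -/
theorem aeval_prod_mem_of_aeval_gradedMapAt_eq_zero (htop : Vs 1 = ⊤)
    (hinv : ∀ a, 1 ≤ a → a ≤ n + 1 → ∀ x ∈ Vs a, f x ∈ Vs a) (p : Fin n → Polynomial K)
    (hp : ∀ i, Polynomial.aeval (gradedMapAt n f Vs hinv i) (p i) = 0) (k : ℕ) (hk : k ≤ n)
    (x : V) :
    Polynomial.aeval f (∏ j : Fin k, p (Fin.castLE hk j)) x ∈ Vs (k + 1) := by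
  induction k with
  | zero => simp [htop]
  | succ k ih =>
    have hy := ih (by omega)
    rw [Fin.prod_univ_castSucc, mul_comm, map_mul, Module.End.mul_apply]
    set y : Vs (k + 1) := ⟨_, hy⟩
    let i : Fin n := ⟨k, hk⟩
    have hA := hinv (k + 1) (by omega) (by omega)
    have h := LinearMap.map_aeval_of_intertwines (f := f.restrict hA)
      (g := gradedMapAt n f Vs hinv i)
      (φ := Submodule.mkQ (Submodule.comap (Vs (k + 1)).subtype (Vs (k + 1 + 1))))
      (fun _ => rfl) (p i) y
    have hs : ((Polynomial.aeval (f.restrict hA) (p i) y : Vs (k + 1)) : V) =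
        Polynomial.aeval f (p i) (y : V) :=
      LinearMap.map_aeval_of_intertwines (φ := (Vs (k + 1)).subtype) (fun _ => rfl) _ _
    rw [hp, LinearMap.zero_apply, Submodule.mkQ_apply, Submodule.Quotient.mk_eq_zero,
      Submodule.mem_comap, Submodule.subtype_apply, hs] at h
    exact h

/-- Members of a chain of submodules that is descending in degrees `1, …, n + 1` are
antitone in those degrees. -/
theorem le_of_descending_chain (hchain : ∀ a, 1 ≤ a → a ≤ n → Vs (a + 1) ≤ Vs a) {a b : ℕ}
    (ha : 1 ≤ a) (hab : a ≤ b) (hb : b ≤ n + 1) : Vs b ≤ Vs a := by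
  induction b, hab using Nat.le_induction with
  | base => exact le_rfl
  | succ b hab ih => exact (hchain b (by omega) (by omega)).trans (ih (by omega))

/-- A component of a filtered map inducing the identity on graded pieces vanishes on the
deeper steps of the filtration. -/
theorem eq_zero_of_eq_mk_of_lt (hchain : ∀ a, 1 ≤ a → a ≤ n → Vs (a + 1) ≤ Vs a)
    {i : Fin n} {φ : V →ₗ[K] GradedPiece Vs (i.val + 1)}
    (hφ : ∀ x : Vs (i.val + 1), φ x = Submodule.Quotient.mk x) {a : ℕ} (hia : i.val < a)
    (ha : a ≤ n) {x : V} (hx : x ∈ Vs (a + 1)) : φ x = 0 := by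
  have hx' := le_of_descending_chain n Vs hchain (a := i.val + 2) (by omega) (by omega)
    (by omega) hx
  have := hφ ⟨x, hchain (i.val + 1) (by omega) i.isLt hx'⟩
  rw [this, Submodule.Quotient.mk_eq_zero]
  exact hx'

/-- Linear maps to the graded pieces that induce the quotient maps jointly form a bijection. -/
theorem bijective_pi_of_eq_mk (htop : Vs 1 = ⊤) (hbot : Vs (n + 1) = ⊥)
    (hchain : ∀ a, 1 ≤ a → a ≤ n → Vs (a + 1) ≤ Vs a)
    (φ : (i : Fin n) → V →ₗ[K] GradedPiece Vs (i.val + 1))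
    (hφ : ∀ (i : Fin n) (x : Vs (i.val + 1)), φ i x = Submodule.Quotient.mk x) :
    Function.Bijective (LinearMap.pi φ) := by
  constructor
  · rw [injective_iff_map_eq_zero]
    intro x hx
    have key : ∀ k ≤ n, x ∈ Vs (k + 1) := by
      intro k
      induction k with
      | zero => simp [htop]
      | succ k ih =>
        intro hk
        have h := congrFun hx ⟨k, hk⟩
        have h' := hφ ⟨k, hk⟩ ⟨x, ih (by omega)⟩
        rw [LinearMap.pi_apply] at h
        rw [h] at h'
        simpa using (Submodule.Quotient.mk_eq_zero _).1 h'.symm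
    simpa [hbot] using key n le_rfl
  · intro y
    have key : ∀ k ≤ n, ∃ x, ∀ i : Fin n, i.val < k → φ i x = y i := by
      intro k
      induction k with
      | zero => simp
      | succ k ih =>
        intro hk
        obtain ⟨x, hx⟩ := ih (by omega)
        obtain ⟨z, hz⟩ := Submodule.Quotient.mk_surjective _ (y ⟨k, hk⟩ - φ ⟨k, hk⟩ x)
        refine ⟨x + z, fun i hi => ?_⟩
        rw [map_add]
        rcases Nat.lt_succ_iff_lt_or_eq.1 hi with h | h
        · rw [hx i h, eq_zero_of_eq_mk_of_lt n Vs hchain (hφ i) h (by omega) z.2, add_zero]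
        · obtain rfl : i = ⟨k, hk⟩ := Fin.ext h
          rw [hφ ⟨k, hk⟩ z, hz, add_sub_cancel]
    obtain ⟨x, hx⟩ := key n le_rfl
    exact ⟨x, funext fun i => hx i i.isLt⟩

end Filtration

/-- Unique splitting of a filtration with pairwise coprime characteristic
polynomials on the graded pieces: if `V = V₁ ⊇ V₂ ⊇ ⋯ ⊇ V_n ⊇ V_{n+1} = 0` is a
chain of `f`-invariant subspaces of a finite-dimensional vector space and the
characteristic polynomials of the induced maps `f̄_a` on the graded pieces
`V_a / V_{a+1}` are pairwise coprime, then there is a unique linear isomorphism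
`Ψ : V ≅ ⊕_{a=1}^{n} V_a / V_{a+1}` intertwining `f` with `⊕_a f̄_a`, mapping each
`V_a` into `⊕_{i ≥ a} V_i / V_{i+1}`, and inducing the identity on each graded
piece. -/
theorem existsUnique_equivariant_splitting_of_filtration
    [FiniteDimensional K V] (n : ℕ) (f : V →ₗ[K] V) (Vs : ℕ → Submodule K V)
    (htop : Vs 1 = ⊤) (hbot : Vs (n + 1) = ⊥)
    (hchain : ∀ a, 1 ≤ a → a ≤ n → Vs (a + 1) ≤ Vs a)
    (hinv : ∀ a, 1 ≤ a → a ≤ n + 1 → ∀ x ∈ Vs a, f x ∈ Vs a)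
    (hcop : ∀ i j : Fin n, i ≠ j →
      IsCoprime (LinearMap.charpoly (gradedMapAt n f Vs hinv i))
        (LinearMap.charpoly (gradedMapAt n f Vs hinv j))) :
    ∃! Ψ : V ≃ₗ[K] ((i : Fin n) → GradedPiece Vs (i.val + 1)),
      (∀ v : V, Ψ (f v) = blockMap n f Vs hinv (Ψ v)) ∧
      (∀ a : Fin n, ∀ x ∈ Vs (a.val + 1),
        ∀ i : Fin n, i.val < a.val → Ψ x i = 0) ∧
      (∀ (a : Fin n) (x : ↥(Vs (a.val + 1))),
        Ψ ↑x a = Submodule.Quotient.mk x) := by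
  have hex (i : Fin n) : ∃! φ : V →ₗ[K] GradedPiece Vs (i.val + 1),
      (∀ x, φ (f x) = gradedMapAt n f Vs hinv i (φ x)) ∧
        ∀ x : Vs (i.val + 1), φ x = Submodule.Quotient.mk x := by
    refine LinearMap.existsUnique_equivariant_extension
      (hinv (i.val + 1) (by omega) (by omega)) (Submodule.mkQ _) (fun _ => rfl)
      (aeval_prod_mem_of_aeval_gradedMapAt_eq_zero n f Vs htop hinv _
        (fun j => LinearMap.aeval_self_charpoly _) i.val i.isLt.le)
      (LinearMap.aeval_self_charpoly _) ?_
    exact IsCoprime.prod_left fun j _ => hcop _ _ (Fin.ne_of_lt j.isLt)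
  choose φ hφ huniq using hex
  refine ⟨LinearEquiv.ofBijective (LinearMap.pi φ)
    (bijective_pi_of_eq_mk n Vs htop hbot hchain φ fun i => (hφ i).2),
    ⟨fun v => funext fun i => (hφ i).1 v, fun a x hx i hi => ?_, fun a x => (hφ a).2 x⟩,
    fun Ψ hΨ => ?_⟩
  · exact eq_zero_of_eq_mk_of_lt n Vs hchain (hφ i).2 hi a.isLt.le hx
  · ext v i
    exact LinearMap.congr_fun (huniq i ((LinearMap.proj i).comp Ψ.toLinearMap)
      ⟨fun x => congrFun (hΨ.1 x) i, hΨ.2.2 i⟩) v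

end
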